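/- (Calabi–Bernstein-type theorem via Weierstrass data) Let Σ be an open Riemann surface, f dz a holomorphic 1-form on Σ, and g a meromorphic function on Σ with |g| < 1 everywhere on Σ, such that dσ² = (1+|g|²)² |f|² |dz|² is a conformal Riemannian metric on Σ (these are the data of a maximal space-like surface in Lorentz–Minkowski 3-space with induced metric ds² = (1−|g|²)² |f|² |dz|² and Lorentzian Gauss map g). If the induced metric ds² = (1−|g|²)² |f|² |dz|² is complete on Σ, then g is constant, i.e., the maximal surface is a plane. -/

import Mathlib

open Filter Set MeasureTheory Topology
open scoped ENNReal

noncomputable section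

/-- Half of the chordal (spherical) distance on the Riemann sphere `OnePoint ℂ`. -/
def sphDist : OnePoint ℂ → OnePoint ℂ → ℝ
  | OnePoint.infty, OnePoint.infty => 0
  | OnePoint.infty, (w : ℂ) => 1 / Real.sqrt (1 + ‖w‖ ^ 2)
  | (z : ℂ), OnePoint.infty => 1 / Real.sqrt (1 + ‖z‖ ^ 2)
  | (z : ℂ), (w : ℂ) => ‖z - w‖ / (Real.sqrt (1 + ‖z‖ ^ 2) * Real.sqrt (1 + ‖w‖ ^ 2))

/-- A map `f : ℂ → Ĉ` is holomorphic on `U` if near each point of `U` it is, in the chart,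
either a coerced holomorphic function or the reciprocal of a holomorphic function. -/
def SphHolomorphicOn (f : ℂ → OnePoint ℂ) (U : Set ℂ) : Prop :=
  ∀ z ∈ U, ∃ V : Set ℂ, IsOpen V ∧ z ∈ V ∧ ∃ h : ℂ → ℂ, DifferentiableOn ℂ h V ∧
    ((∀ w ∈ V, f w = (h w : OnePoint ℂ)) ∨
     (∀ w ∈ V, f w = if h w = 0 then OnePoint.infty else (((h w)⁻¹ : ℂ) : OnePoint ℂ)))

/-- Locally uniform convergence on `U` with respect to the spherical distance. -/
def SphLocUnifOn (F : ℕ → ℂ → OnePoint ℂ) (f : ℂ → OnePoint ℂ) (U : Set ℂ) : Prop :=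
  ∀ K : Set ℂ, K ⊆ U → IsCompact K → ∀ ε > (0:ℝ),
    ∀ᶠ n in Filter.atTop, ∀ z ∈ K, sphDist (F n z) (f z) < ε

/-- Locally uniform convergence of real-valued functions on `U`. -/
def RealLocUnifOn (F : ℕ → ℂ → ℝ) (f : ℂ → ℝ) (U : Set ℂ) : Prop :=
  ∀ K : Set ℂ, K ⊆ U → IsCompact K → ∀ ε > (0:ℝ),
    ∀ᶠ n in Filter.atTop, ∀ z ∈ K, |F n z - f z| < ε

/-- A closed property for holomorphic maps into the Riemann sphere (on plane domains). -/
structure IsClosedProperty (P : Set ℂ → (ℂ → OnePoint ℂ) → Prop) : Prop where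
  mem_holo : ∀ (U : Set ℂ) (f : ℂ → OnePoint ℂ), IsOpen U → IsConnected U →
    P U f → SphHolomorphicOn f U
  /-- (P1): stability under precomposition with unramified holomorphic maps. -/
  comp : ∀ (U V : Set ℂ) (φ : ℂ → ℂ) (f : ℂ → OnePoint ℂ),
    IsOpen U → IsConnected U → IsOpen V → IsConnected V →
    DifferentiableOn ℂ φ U → Set.MapsTo φ U V → (∀ z ∈ U, deriv φ z ≠ 0) →
    P V f → P U (f ∘ φ)
  /-- (P2): if `f` has the property on every relatively compact subdomain, it has it globally. -/
  exhaust : ∀ (U : Set ℂ) (f : ℂ → OnePoint ℂ), IsOpen U → IsConnected U →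
    SphHolomorphicOn f U →
    (∀ Ω : Set ℂ, IsOpen Ω → IsConnected Ω → IsCompact (closure Ω) → closure Ω ⊆ U → P Ω f) →
    P U f
  /-- (P3): `𝒫(U)` is closed under locally uniform spherical convergence in `𝑀(U)`. -/
  closed : ∀ (U : Set ℂ) (f : ℂ → OnePoint ℂ) (F : ℕ → ℂ → OnePoint ℂ),
    IsOpen U → IsConnected U → (∀ n, P U (F n)) → SphLocUnifOn F f U →
    SphHolomorphicOn f U → P U f

/-- A compact property: a closed property all of whose families `𝒫(U)` are normal. -/
structure IsCompactProperty (P : Set ℂ → (ℂ → OnePoint ℂ) → Prop) extends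
    IsClosedProperty P : Prop where
  /-- (P4): normality of `𝒫(U)` for every domain `U`. -/
  normal : ∀ (U : Set ℂ), IsOpen U → IsConnected U →
    ∀ F : ℕ → ℂ → OnePoint ℂ, (∀ n, P U (F n)) →
      ∃ φ : ℕ → ℕ, StrictMono φ ∧ ∃ g : ℂ → OnePoint ℂ, SphLocUnifOn (F ∘ φ) g U

/-- The spherical derivative of a map into the Riemann sphere (limit of spherical
difference quotients). For `f` meromorphic near `z` this equals `|f'|/(1+|f|²)`. -/
def sphD (f : ℂ → OnePoint ℂ) (z : ℂ) : ℝ :=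
  limUnder (𝓝[≠] z) (fun w => sphDist (f w) (f z) / ‖w - z‖)

/-- A Weierstrass `m`-triple on a plane domain `U`: a holomorphic `1`-form `f dz`, a
meromorphic function `g`, and the (continuous positive) conformal density `lam` of the
metric `ds² = (1+|g|²)^m |f|² |dz|²`. -/
structure WeierstrassTriple (m : ℕ) (U : Set ℂ) where
  isOpen : IsOpen U
  isConnected : IsConnected U
  f : ℂ → ℂ
  g : ℂ → OnePoint ℂ
  f_holo : DifferentiableOn ℂ f U
  g_holo : SphHolomorphicOn g U
  g_mero : ∃ z ∈ U, g z ≠ OnePoint.infty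
  lam : ℂ → ℝ
  lam_cont : ContinuousOn lam U
  lam_pos : ∀ z ∈ U, 0 < lam z
  lam_eq : ∀ z ∈ U, ∀ w : ℂ, g z = (w : OnePoint ℂ) →
    lam z = (1 + ‖w‖ ^ 2) ^ ((m : ℝ) / 2) * ‖f z‖

/-- The Gaussian curvature `K = -2m |g'|²/((1+|g|²)^{m+2}|f|²)` of a Weierstrass
`m`-triple, written via the spherical derivative: `K = -2m (g^#)² / λ²`. -/
def WeierstrassTriple.curv {m : ℕ} {U : Set ℂ} (T : WeierstrassTriple m U) (z : ℂ) : ℝ :=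
  -(2 * m) * (sphD T.g z) ^ 2 / (T.lam z) ^ 2

/-- A divergent `C¹` path in `U` starting at `p`, parametrized by `[0,1)`. -/
structure DivergentPath (U : Set ℂ) (p : ℂ) where
  toFun : ℝ → ℂ
  start : toFun 0 = p
  mem : ∀ t ∈ Set.Ico (0:ℝ) 1, toFun t ∈ U
  cont : ContinuousOn toFun (Set.Ico (0:ℝ) 1)
  diff : ∀ t ∈ Set.Ioo (0:ℝ) 1, DifferentiableAt ℝ toFun t
  divergent : ∀ K : Set ℂ, IsCompact K → K ⊆ U →
    ∃ t₀ ∈ Set.Ico (0:ℝ) 1, ∀ t, t₀ ≤ t → t < 1 → toFun t ∉ K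

/-- The length of a path with respect to the conformal metric with density `lam`. -/
def pathLen (lam : ℂ → ℝ) (γ : ℝ → ℂ) : ℝ≥0∞ :=
  ∫⁻ t in Set.Ioo (0:ℝ) 1, ENNReal.ofReal (lam (γ t) * ‖deriv γ t‖)

/-- The geodesic distance from `p` to the boundary of `U`: the infimum of lengths of
divergent paths starting at `p`. -/
def distToBdry (lam : ℂ → ℝ) (U : Set ℂ) (p : ℂ) : ℝ≥0∞ :=
  ⨅ γ : DivergentPath U p, pathLen lam γ.toFun

/-- Completeness of the conformal metric with density `lam` on `U`: every divergent path
has infinite length. -/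
def IsCompleteMetric (lam : ℂ → ℝ) (U : Set ℂ) : Prop :=
  ∀ p ∈ U, ∀ γ : DivergentPath U p, pathLen lam γ.toFun = ⊤

/-- The property `P_L`: `|f| < L` on `U`, or `f` is constant on `U`. -/
def PL (L : ℝ) (U : Set ℂ) (f : ℂ → OnePoint ℂ) : Prop :=
  SphHolomorphicOn f U ∧
    ((∀ z ∈ U, ∃ w : ℂ, f z = (w : OnePoint ℂ) ∧ ‖w‖ < L) ∨
      (∀ z ∈ U, ∀ w ∈ U, f z = f w))

/-- The property `P_X`: `f` omits every value of `X`, or `f` is constant on `U`. -/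
def PX (X : Set (OnePoint ℂ)) (U : Set ℂ) (f : ℂ → OnePoint ℂ) : Prop :=
  SphHolomorphicOn f U ∧ ((∀ z ∈ U, f z ∉ X) ∨ (∀ z ∈ U, ∀ w ∈ U, f z = f w))

/-- Second directional derivative of `u : ℂ → ℝ` at `z` in direction `v`. -/
def dirDeriv2 (u : ℂ → ℝ) (z v : ℂ) : ℝ :=
  deriv (deriv (fun t : ℝ => u (z + t • v))) 0

/-- The Euclidean Laplacian of `u : ℂ → ℝ`. -/
def laplacian (u : ℂ → ℝ) (z : ℂ) : ℝ :=
  dirDeriv2 u z 1 + dirDeriv2 u z Complex.I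


/-- A compact property `P` satisfies the `m`-curvature estimate if there is `C > 0` such
that `|K| d² ≤ C` for every Weierstrass `m`-triple whose meromorphic function satisfies `P`. -/
def SatisfiesCurvatureEstimate (P : Set ℂ → (ℂ → OnePoint ℂ) → Prop) (m : ℕ) : Prop :=
  ∃ C : ℝ, 0 < C ∧ ∀ (U : Set ℂ) (T : WeierstrassTriple m U), P U T.g →
    ∀ p ∈ U, ENNReal.ofReal |T.curv p| * (distToBdry T.lam U p) ^ 2 ≤ ENNReal.ofReal C

/-- `φ` maps `V` into `U` and solves the complex differential equation `φ' = 1 / f(φ)` on `V`;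
equivalently, `φ` is a local isometry from the flat plane to `U` with metric `|f|²|dz|²`. -/
def IsFlatParam (U : Set ℂ) (f : ℂ → ℂ) (φ : ℂ → ℂ) (V : Set ℂ) : Prop :=
  ∀ z ∈ V, φ z ∈ U ∧ HasDerivAt φ (f (φ z))⁻¹ z

theorem IsFlatParam.mono {U V W : Set ℂ} {f φ : ℂ → ℂ} (h : IsFlatParam U f φ V) (hW : W ⊆ V) :
    IsFlatParam U f φ W :=
  fun z hz => h z (hW hz)

theorem IsFlatParam.differentiableOn {U V : Set ℂ} {f φ : ℂ → ℂ} (h : IsFlatParam U f φ V) :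
    DifferentiableOn ℂ φ V :=
  fun z hz => (h z hz).2.differentiableAt.differentiableWithinAt

/-- Local primitives of a nowhere vanishing holomorphic function are local charts. -/
theorem exists_primitive_chart {U : Set ℂ} (hU : IsOpen U) {f : ℂ → ℂ}
    (hf : DifferentiableOn ℂ f U) (hreg : ∀ z ∈ U, f z ≠ 0) {q : ℂ} (hq : q ∈ U) :
    ∃ e : OpenPartialHomeomorph ℂ ℂ, q ∈ e.source ∧ e.source ⊆ U ∧
      ∀ z ∈ e.source, HasDerivAt e (f z) z := by
  obtain ⟨s, hs, hsU⟩ := Metric.isOpen_iff.1 hU q hq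
  obtain ⟨F, hF⟩ := (hf.mono hsU).isExactOn_ball
  have hFd : DifferentiableOn ℂ F (Metric.ball q s) :=
    fun z hz => (hF z hz).differentiableAt.differentiableWithinAt
  have hqs : q ∈ Metric.ball q s := Metric.mem_ball_self hs
  have hstrict : HasStrictDerivAt F (f q) q := by
    have := ((hFd.analyticAt (Metric.isOpen_ball.mem_nhds hqs)).contDiffAt (n := 1)).hasStrictDerivAt
      (by simp)
    rwa [(hF q hqs).deriv] at this
  have hequiv := hstrict.hasStrictFDerivAt_equiv (hreg q hq)
  refine ⟨(hequiv.toOpenPartialHomeomorph F).restrOpen (Metric.ball q s) Metric.isOpen_ball,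
    ⟨hequiv.mem_toOpenPartialHomeomorph_source, hqs⟩, fun z hz => hsU hz.2, fun z hz => ?_⟩
  exact hF z hz.2

/-- Solutions of `φ' = 1 / f(φ)` are determined by one value. -/
theorem IsFlatParam.eqOn {U V : Set ℂ} (hU : IsOpen U) {f φ ψ : ℂ → ℂ}
    (hf : DifferentiableOn ℂ f U) (hreg : ∀ z ∈ U, f z ≠ 0) (hV : IsOpen V)
    (hVc : IsPreconnected V) (hφ : IsFlatParam U f φ V) (hψ : IsFlatParam U f ψ V)
    {z₀ : ℂ} (hz₀ : z₀ ∈ V) (h : φ z₀ = ψ z₀) : EqOn φ ψ V := by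
  refine (hφ.differentiableOn.analyticOnNhd hV).eqOn_of_preconnected_of_eventuallyEq
    (hψ.differentiableOn.analyticOnNhd hV) hVc hz₀ ?_
  obtain ⟨e, he, heU, hde⟩ := exists_primitive_chart hU hf hreg (hφ z₀ hz₀).1
  have h1 : ∀ᶠ z in 𝓝 z₀, φ z ∈ e.source :=
    (hφ z₀ hz₀).2.continuousAt.eventually (e.open_source.mem_nhds he)
  have h2 : ∀ᶠ z in 𝓝 z₀, ψ z ∈ e.source :=
    (hψ z₀ hz₀).2.continuousAt.eventually (e.open_source.mem_nhds (h ▸ he))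
  obtain ⟨r, hr, hball⟩ := Metric.eventually_nhds_iff_ball.1 ((hV.eventually_mem hz₀).and (h1.and h2))
  have key : ∀ χ : ℂ → ℂ, IsFlatParam U f χ V → (∀ z ∈ Metric.ball z₀ r, χ z ∈ e.source) →
      ∀ z ∈ Metric.ball z₀ r, HasDerivAt (e ∘ χ) 1 z := by
    intro χ hχ hχe z hz
    have h3 := (hde _ (hχe z hz)).comp z (hχ z (hball z hz).1).2
    rwa [mul_inv_cancel₀ (hreg _ (heU (hχe z hz)))] at h3
  have k1 := key φ hφ fun z hz => (hball z hz).2.1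
  have k2 := key ψ hψ fun z hz => (hball z hz).2.2
  have heq : EqOn (e ∘ φ) (e ∘ ψ) (Metric.ball z₀ r) :=
    Metric.isOpen_ball.eqOn_of_deriv_eq (convex_ball z₀ r).isPreconnected
      (fun z hz => (k1 z hz).differentiableAt.differentiableWithinAt)
      (fun z hz => (k2 z hz).differentiableAt.differentiableWithinAt)
      (fun z hz => by rw [(k1 z hz).deriv, (k2 z hz).deriv])
      (Metric.mem_ball_self hr) (by simp [h])
  filter_upwards [Metric.ball_mem_nhds z₀ hr] with z hz
  exact e.injOn (hball z hz).2.1 (hball z hz).2.2 (heq hz)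

/-- On a compact set of initial values, solutions of `φ' = 1 / f(φ)` exist on discs of a
uniform radius. -/
theorem IsCompact.exists_isFlatParam_ball {U K : Set ℂ} (hU : IsOpen U) {f : ℂ → ℂ}
    (hf : DifferentiableOn ℂ f U) (hreg : ∀ z ∈ U, f z ≠ 0) (hK : IsCompact K) (hKU : K ⊆ U) :
    ∃ ε > 0, ∀ q ∈ K, ∀ w : ℂ, ∃ ψ : ℂ → ℂ, ψ w = q ∧ IsFlatParam U f ψ (Metric.ball w ε) := by
  refine hK.induction_on (p := fun A => ∃ ε > 0, ∀ q ∈ A, ∀ w : ℂ, ∃ ψ : ℂ → ℂ, ψ w = q ∧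
    IsFlatParam U f ψ (Metric.ball w ε)) ⟨1, one_pos, by simp⟩ ?_ ?_ ?_
  · rintro s t hst ⟨ε, hε, h⟩
    exact ⟨ε, hε, fun q hq => h q (hst hq)⟩
  · rintro s t ⟨ε₁, hε₁, h₁⟩ ⟨ε₂, hε₂, h₂⟩
    refine ⟨min ε₁ ε₂, lt_min hε₁ hε₂, ?_⟩
    rintro q (hq | hq) w
    · obtain ⟨ψ, hψ, hs⟩ := h₁ q hq w
      exact ⟨ψ, hψ, hs.mono (Metric.ball_subset_ball (min_le_left _ _))⟩
    · obtain ⟨ψ, hψ, hs⟩ := h₂ q hq w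
      exact ⟨ψ, hψ, hs.mono (Metric.ball_subset_ball (min_le_right _ _))⟩
  · intro q hq
    obtain ⟨e, he, heU, hde⟩ := exists_primitive_chart hU hf hreg (hKU hq)
    obtain ⟨r, hr, hball⟩ := Metric.isOpen_iff.1 e.open_target _ (e.map_source he)
    have hN : e.source ∩ e ⁻¹' Metric.ball (e q) (r / 2) ∈ 𝓝 q :=
      inter_mem (e.open_source.mem_nhds he)
        ((e.continuousAt he) (Metric.ball_mem_nhds _ (half_pos hr)))
    refine ⟨_, mem_nhdsWithin_of_mem_nhds hN, r / 2, half_pos hr, fun p hp w => ?_⟩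
    refine ⟨fun z => e.symm (e p + (z - w)), by simp [e.left_inv hp.1], fun z hz => ?_⟩
    have hz' : e p + (z - w) ∈ e.target := by
      apply hball
      have h1 : dist (e p) (e q) < r / 2 := hp.2
      have h2 : dist z w < r / 2 := hz
      rw [dist_eq_norm] at h1 h2
      rw [Metric.mem_ball, dist_eq_norm]
      calc ‖e p + (z - w) - e q‖ = ‖(e p - e q) + (z - w)‖ := by ring_nf
        _ ≤ ‖e p - e q‖ + ‖z - w‖ := norm_add_le _ _
        _ < r := by linarith
    have hsrc := e.map_target hz'
    refine ⟨heU hsrc, ?_⟩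
    have h3 := e.hasDerivAt_symm hz' (hreg _ (heU hsrc)) (hde _ hsrc)
    have h4 : HasDerivAt (fun z => e p + (z - w)) 1 z :=
      ((hasDerivAt_id z).sub_const w).const_add (e p)
    have h5 := h3.comp z h4
    rwa [mul_one] at h5

/-- Compatible solutions of `φ' = 1 / f(φ)` on open sets glue to a solution on the union. -/
theorem IsFlatParam.exists_glue {ι : Type*} {U : Set ℂ} {f : ℂ → ℂ} {V : ι → Set ℂ}
    {φ : ι → ℂ → ℂ} (hV : ∀ i, IsOpen (V i)) (hφ : ∀ i, IsFlatParam U f (φ i) (V i))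
    (hcompat : ∀ i j, EqOn (φ i) (φ j) (V i ∩ V j)) :
    ∃ Φ : ℂ → ℂ, IsFlatParam U f Φ (⋃ i, V i) ∧ ∀ i, EqOn Φ (φ i) (V i) := by
  classical
  set Φ : ℂ → ℂ := fun z => if h : ∃ i, z ∈ V i then φ h.choose z else 0 with hΦ
  have heq : ∀ i, EqOn Φ (φ i) (V i) := by
    intro i z hz
    have h : ∃ i, z ∈ V i := ⟨i, hz⟩
    simp only [hΦ, dif_pos h]
    exact hcompat _ _ ⟨h.choose_spec, hz⟩
  refine ⟨Φ, fun z hz => ?_, heq⟩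
  obtain ⟨i, hi⟩ := mem_iUnion.1 hz
  rw [heq i hi]
  exact ⟨(hφ i z hi).1, (hφ i z hi).2.congr_of_eventuallyEq
    ((heq i).eventuallyEq_of_mem ((hV i).mem_nhds hi))⟩

/-- If the metric is complete, a solution on a disc extends across each boundary point. -/
theorem IsFlatParam.exists_extend_boundary {U : Set ℂ} (hU : IsOpen U) {f φ : ℂ → ℂ} {lam : ℂ → ℝ}
    (hf : DifferentiableOn ℂ f U) (hreg : ∀ z ∈ U, f z ≠ 0) (hlam : ∀ z ∈ U, lam z ≤ ‖f z‖)
    (hcomp : IsCompleteMetric lam U) {R : ℝ} (hR : 0 < R)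
    (hφ : IsFlatParam U f φ (Metric.ball 0 R)) {w : ℂ} (hw : ‖w‖ = R) :
    ∃ ε > 0, ∃ ψ : ℂ → ℂ, IsFlatParam U f ψ (Metric.ball w ε) ∧
      EqOn ψ φ (Metric.ball w ε ∩ Metric.ball 0 R) := by
  have hmem : ∀ t : ℝ, 0 ≤ t → t < 1 → (t : ℂ) * w ∈ Metric.ball (0 : ℂ) R := by
    intro t h0 h1
    rw [mem_ball_zero_iff, norm_mul, Complex.norm_real, Real.norm_of_nonneg h0, hw]
    nlinarith
  have hd : ∀ t : ℝ, 0 ≤ t → t < 1 →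
      HasDerivAt (fun s : ℝ => φ (s * w)) ((f (φ (t * w)))⁻¹ * w) t := by
    intro t h0 h1
    have h2 : HasDerivAt (fun s : ℂ => s * w) w (t : ℂ) := by
      simpa using (hasDerivAt_id (t : ℂ)).mul_const w
    exact ((hφ _ (hmem t h0 h1)).2.comp (t : ℂ) h2).comp_ofReal
  obtain ⟨K, hK, hKU, hret⟩ : ∃ K : Set ℂ, IsCompact K ∧ K ⊆ U ∧
      ∀ t₀ ∈ Ico (0 : ℝ) 1, ∃ t, t₀ ≤ t ∧ t < 1 ∧ φ (t * w) ∈ K := by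
    by_contra! hcon
    let γ : DivergentPath U (φ 0) :=
      { toFun := fun t => φ (t * w)
        start := by simp
        mem := fun t ht => (hφ _ (hmem t ht.1 ht.2)).1
        cont := fun t ht => (hd t ht.1 ht.2).continuousAt.continuousWithinAt
        diff := fun t ht => (hd t ht.1.le ht.2).differentiableAt
        divergent := hcon }
    have htop := hcomp (φ 0) (hφ 0 (Metric.mem_ball_self hR)).1 γ
    have hle : pathLen lam γ.toFun ≤ ∫⁻ _ in Ioo (0 : ℝ) 1, ENNReal.ofReal R := by
      refine setLIntegral_mono measurable_const fun t ht => ENNReal.ofReal_le_ofReal ?_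
      have hU' := (hφ _ (hmem t ht.1.le ht.2)).1
      have hne : ‖f (φ (t * w))‖ ≠ 0 := norm_ne_zero_iff.2 (hreg _ hU')
      change lam (φ (t * w)) * ‖deriv (fun s : ℝ => φ (s * w)) t‖ ≤ R
      rw [(hd t ht.1.le ht.2).deriv, norm_mul, norm_inv, hw]
      calc lam (φ (t * w)) * (‖f (φ (t * w))‖⁻¹ * R)
          ≤ ‖f (φ (t * w))‖ * (‖f (φ (t * w))‖⁻¹ * R) := by
            gcongr
            exact hlam _ hU'
        _ = R := by field_simp
    rw [htop] at hle
    simp at hle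
  obtain ⟨ε, hε, hex⟩ := hK.exists_isFlatParam_ball hU hf hreg hKU
  obtain ⟨t, ht0, ht1, htK⟩ := hret (max 0 (1 - ε / (2 * R)))
    ⟨le_max_left _ _, max_lt one_pos (by linarith [show 0 < ε / (2 * R) by positivity])⟩
  have ht0' : 0 ≤ t := (le_max_left _ _).trans ht0
  have htR : (1 - t) * R ≤ ε / 2 := by
    have h1 : 1 - t ≤ ε / (2 * R) := by linarith [(le_max_right 0 (1 - ε / (2 * R))).trans ht0]
    calc (1 - t) * R ≤ ε / (2 * R) * R := by gcongr
      _ = ε / 2 := by field_simp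
  obtain ⟨ψ, hψt, hψ⟩ := hex _ htK (t * w)
  have hsub : Metric.ball w (ε / 2) ⊆ Metric.ball (t * w) ε := by
    refine Metric.ball_subset_ball' ?_
    have : dist w (t * w) = (1 - t) * R := by
      rw [dist_eq_norm, show w - t * w = ((1 - t : ℝ) : ℂ) * w by push_cast; ring, norm_mul,
        Complex.norm_real, Real.norm_of_nonneg (by linarith), hw]
    linarith
  refine ⟨ε / 2, half_pos hε, ψ, hψ.mono hsub, ?_⟩
  refine EqOn.mono (inter_subset_inter_left _ hsub) ?_
  exact (hψ.mono inter_subset_left).eqOn hU hf hreg (Metric.isOpen_ball.inter Metric.isOpen_ball)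
    ((convex_ball _ _).inter (convex_ball _ _)).isPreconnected (hφ.mono inter_subset_right)
    ⟨Metric.mem_ball_self hε, hmem t ht0' ht1⟩ hψt

/-- Two intersecting discs with distinct centres in a closed disc intersect inside the open disc. -/
theorem exists_mem_ball_inter_ball_inter_ball {R a b : ℝ} {c d z : ℂ}
    (hc : c ∈ Metric.closedBall (0 : ℂ) R) (hd : d ∈ Metric.closedBall (0 : ℂ) R) (hcd : c ≠ d)
    (hzc : z ∈ Metric.ball c a) (hzd : z ∈ Metric.ball d b) :
    ∃ m, m ∈ Metric.ball c a ∧ m ∈ Metric.ball d b ∧ m ∈ Metric.ball (0 : ℂ) R := by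
  have ha : 0 < a := Metric.pos_of_mem_ball hzc
  have hb : 0 < b := Metric.pos_of_mem_ball hzd
  have hdist : ‖d - c‖ < a + b := by
    have := dist_triangle d z c
    rw [← dist_eq_norm]
    linarith [Metric.mem_ball'.1 hzd, Metric.mem_ball.1 hzc]
  have hab : (a : ℂ) + b ≠ 0 := by exact_mod_cast (add_pos ha hb).ne'
  have hs : ∀ x : ℝ, 0 < x → ‖((x / (a + b) : ℝ) : ℂ) * (d - c)‖ < x := by
    intro x hx
    rw [norm_mul, Complex.norm_real, Real.norm_of_nonneg (by positivity), div_mul_eq_mul_div,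
      div_lt_iff₀ (by positivity)]
    gcongr
  refine ⟨c + ((a / (a + b) : ℝ) : ℂ) * (d - c), ?_, ?_, ?_⟩
  · rw [Metric.mem_ball, dist_eq_norm, add_sub_cancel_left]
    exact hs a ha
  · rw [Metric.mem_ball', dist_eq_norm]
    have hm : d - (c + ((a / (a + b) : ℝ) : ℂ) * (d - c)) = ((b / (a + b) : ℝ) : ℂ) * (d - c) := by
      push_cast
      field_simp
      ring
    rw [hm]
    exact hs b hb
  · have hR : R ≠ 0 := by
      rintro rfl
      simp only [Metric.closedBall_zero, mem_singleton_iff] at hc hd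
      exact hcd (hc.trans hd.symm)
    rw [← interior_closedBall (0 : ℂ) hR]
    refine (strictConvex_closedBall ℝ (0 : ℂ) R).openSegment_subset hc hd hcd ?_
    refine ⟨b / (a + b), a / (a + b), by positivity, by positivity, by field_simp; ring, ?_⟩
    simp only [Complex.real_smul]
    push_cast
    field_simp
    ring

/-- If the metric is complete, a solution on a disc extends to a larger concentric disc. -/
theorem IsFlatParam.exists_extend_ball {U : Set ℂ} (hU : IsOpen U) {f φ : ℂ → ℂ} {lam : ℂ → ℝ}
    (hf : DifferentiableOn ℂ f U) (hreg : ∀ z ∈ U, f z ≠ 0) (hlam : ∀ z ∈ U, lam z ≤ ‖f z‖)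
    (hcomp : IsCompleteMetric lam U) {R : ℝ} (hR : 0 < R)
    (hφ : IsFlatParam U f φ (Metric.ball 0 R)) :
    ∃ δ > 0, ∃ ψ : ℂ → ℂ, ψ 0 = φ 0 ∧ IsFlatParam U f ψ (Metric.ball 0 (R + δ)) := by
  have hloc : ∀ c : Metric.closedBall (0 : ℂ) R, ∃ ε > 0, ∃ ψ : ℂ → ℂ,
      IsFlatParam U f ψ (Metric.ball c ε) ∧ EqOn ψ φ (Metric.ball c ε ∩ Metric.ball 0 R) := by
    rintro ⟨c, hc⟩
    rcases (mem_closedBall_zero_iff.1 hc).lt_or_eq with h | h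
    · obtain ⟨ε, hε, hsub⟩ := Metric.isOpen_iff.1 Metric.isOpen_ball c (mem_ball_zero_iff.2 h)
      exact ⟨ε, hε, φ, hφ.mono hsub, fun _ _ => rfl⟩
    · exact hφ.exists_extend_boundary hU hf hreg hlam hcomp hR h
  choose ε hε ψ hψ hψφ using hloc
  obtain ⟨Φ, hΦ, hΦψ⟩ := IsFlatParam.exists_glue (fun _ => Metric.isOpen_ball) hψ (by
    intro c d z hz
    by_cases hcd : c = d
    · rw [hcd]
    obtain ⟨m, hmc, hmd, hm⟩ := exists_mem_ball_inter_ball_inter_ball c.2 d.2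
      (fun h => hcd (Subtype.ext h)) hz.1 hz.2
    exact ((hψ c).mono inter_subset_left).eqOn hU hf hreg
      (Metric.isOpen_ball.inter Metric.isOpen_ball)
      ((convex_ball _ _).inter (convex_ball _ _)).isPreconnected ((hψ d).mono inter_subset_right)
      ⟨hmc, hmd⟩ ((hψφ c ⟨hmc, hm⟩).trans (hψφ d ⟨hmd, hm⟩).symm) hz)
  obtain ⟨δ, hδ, hsub⟩ := (isCompact_closedBall (0 : ℂ) R).exists_thickening_subset_open
    (isOpen_iUnion fun c : Metric.closedBall (0 : ℂ) R =>
      Metric.isOpen_ball (x := (c : ℂ)) (ε := ε c))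
    (fun c hc => mem_iUnion.2 ⟨⟨c, hc⟩, Metric.mem_ball_self (hε _)⟩)
  rw [thickening_closedBall hδ hR.le, add_comm] at hsub
  let o : Metric.closedBall (0 : ℂ) R := ⟨0, Metric.mem_closedBall_self hR.le⟩
  have ho : (0 : ℂ) ∈ Metric.ball (o : ℂ) (ε o) := Metric.mem_ball_self (hε o)
  exact ⟨δ, hδ, Φ, (hΦψ o ho).trans (hψφ o ⟨ho, Metric.mem_ball_self hR⟩), hΦ.mono hsub⟩

/-- If the metric is complete, `φ' = 1 / f(φ)` is solvable on discs of every radius. -/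
theorem IsCompleteMetric.exists_isFlatParam {U : Set ℂ} (hU : IsOpen U) {f : ℂ → ℂ} {lam : ℂ → ℝ}
    (hf : DifferentiableOn ℂ f U) (hreg : ∀ z ∈ U, f z ≠ 0) (hlam : ∀ z ∈ U, lam z ≤ ‖f z‖)
    (hcomp : IsCompleteMetric lam U) {p : ℂ} (hp : p ∈ U) (r : ℝ) :
    ∃ φ : ℂ → ℂ, φ 0 = p ∧ IsFlatParam U f φ (Metric.ball 0 r) := by
  let S : Set ℝ := {r | 0 < r ∧ ∃ φ : ℂ → ℂ, φ 0 = p ∧ IsFlatParam U f φ (Metric.ball 0 r)}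
  have hne : S.Nonempty := by
    obtain ⟨ε, hε, h⟩ := isCompact_singleton.exists_isFlatParam_ball hU hf hreg
      (singleton_subset_iff.2 hp)
    exact ⟨ε, hε, h p rfl 0⟩
  by_cases hbdd : BddAbove S
  · exfalso
    obtain ⟨r₀, hr₀⟩ := hne
    have hR : 0 < sSup S := hr₀.1.trans_le (le_csSup hbdd hr₀)
    have hall : ∀ s : S, ∃ φ : ℂ → ℂ, φ 0 = p ∧ IsFlatParam U f φ (Metric.ball 0 s) :=
      fun s => s.2.2
    choose φ hφ0 hφ using hall
    obtain ⟨Φ, hΦ, hΦφ⟩ := IsFlatParam.exists_glue (fun _ => Metric.isOpen_ball) hφ (by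
      intro s t
      exact ((hφ s).mono inter_subset_left).eqOn hU hf hreg
        (Metric.isOpen_ball.inter Metric.isOpen_ball)
        ((convex_ball _ _).inter (convex_ball _ _)).isPreconnected
        ((hφ t).mono inter_subset_right)
        ⟨Metric.mem_ball_self s.2.1, Metric.mem_ball_self t.2.1⟩ ((hφ0 s).trans (hφ0 t).symm))
    have hsub : Metric.ball (0 : ℂ) (sSup S) ⊆ ⋃ s : S, Metric.ball 0 (s : ℝ) := by
      intro z hz
      obtain ⟨s, hs, hzs⟩ := exists_lt_of_lt_csSup ⟨r₀, hr₀⟩ (mem_ball_zero_iff.1 hz)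
      exact mem_iUnion.2 ⟨⟨s, hs⟩, mem_ball_zero_iff.2 hzs⟩
    obtain ⟨δ, hδ, ψ, hψ0, hψ⟩ :=
      (hΦ.mono hsub).exists_extend_ball hU hf hreg hlam hcomp hR
    have hΦ0 : Φ 0 = p := (hΦφ ⟨r₀, hr₀⟩ (Metric.mem_ball_self hr₀.1)).trans (hφ0 _)
    have : sSup S + δ ∈ S := ⟨by positivity, ψ, hψ0.trans hΦ0, hψ⟩
    linarith [le_csSup hbdd this]
  · rw [not_bddAbove_iff] at hbdd
    obtain ⟨s, ⟨_, φ, hφ0, hφ⟩, hrs⟩ := hbdd r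
    exact ⟨φ, hφ0, hφ.mono (Metric.ball_subset_ball hrs.le)⟩

/-- Calabi–Bernstein-type theorem via Weierstrass data: for maxface data `(f dz, g)` on a
domain `U` with `|g| < 1` and `(1+|g|²)²|f|²|dz|²` Riemannian (i.e. `f ≠ 0` on `U`), if
the induced metric `(1-|g|²)²|f|²|dz|²` is complete on `U`, then `g` is constant, i.e.
the maximal surface is a plane. -/
theorem calabi_bernstein (U : Set ℂ) (hU : IsOpen U) (hUc : IsConnected U)
    (f g : ℂ → ℂ) (hf : DifferentiableOn ℂ f U) (hg : DifferentiableOn ℂ g U)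
    (hg1 : ∀ z ∈ U, ‖g z‖ < 1)
    (hreg : ∀ z ∈ U, f z ≠ 0)
    (hcomp : IsCompleteMetric (fun z => (1 - ‖g z‖ ^ 2) * ‖f z‖) U) :
    ∀ z ∈ U, ∀ w ∈ U, g z = g w := by
  intro z hz w hw
  refine hU.is_const_of_deriv_eq_zero hUc.isPreconnected hg (fun p hp => ?_) hz hw
  have hlam : ∀ z ∈ U, (1 - ‖g z‖ ^ 2) * ‖f z‖ ≤ ‖f z‖ := fun z _ =>
    mul_le_of_le_one_left (norm_nonneg _) (sub_le_self _ (by positivity))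
  have hbound : ∀ r > 0, ‖deriv g p * (f p)⁻¹‖ ≤ 2 / r := by
    intro r hr
    obtain ⟨φ, hφ0, hφ⟩ := hcomp.exists_isFlatParam hU hf hreg hlam hp r
    have h0 : (0 : ℂ) ∈ Metric.ball (0 : ℂ) r := Metric.mem_ball_self hr
    have hmaps : MapsTo φ (Metric.ball 0 r) U := fun z hz => (hφ z hz).1
    have hderiv : HasDerivAt (g ∘ φ) (deriv g p * (f p)⁻¹) 0 := by
      have h1 := (hg.differentiableAt (hU.mem_nhds hp)).hasDerivAt
      have h2 := (hφ 0 h0).2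
      rw [← hφ0] at h1 ⊢
      exact h1.comp 0 h2
    rw [← hderiv.deriv]
    refine Complex.norm_deriv_le_div_of_mapsTo_ball (hg.comp hφ.differentiableOn hmaps) ?_ hr
    intro z hz
    rw [Metric.mem_closedBall, dist_eq_norm]
    have h1 := hg1 _ (hmaps hz)
    have h2 := hg1 _ (hmaps h0)
    simp only [Function.comp_apply]
    linarith [norm_sub_le (g (φ z)) (g (φ 0))]
  have hzero : ‖deriv g p * (f p)⁻¹‖ ≤ 0 :=
    ge_of_tendsto (tendsto_const_nhds.div_atTop tendsto_id)
      ((eventually_gt_atTop 0).mono hbound)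
  change deriv g p = 0
  simpa only [norm_le_zero_iff, mul_eq_zero, inv_eq_zero, hreg p hp, or_false] using hzero

end
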